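/- In the prepare-and-measure scenario on ℂ² with n settings: suppose the target pure qubit states ρ^x_a (a∈{1,2}, x∈[n]) are such that for each x the pair (ρ^x_1, ρ^x_2) consists of rank-one orthogonal projections with ρ^x_1 + ρ^x_2 = I, and suppose the experimental density matrices ρ̃^x_a on ℂ² and experimental 2-outcome POVMs on ℂ² generate statistics ε-close to the target ones (|Re tr(ρ̃^x_a M̃^y_b) − Re tr(ρ^x_a ρ^y_b)| ≤ ε for all a,b,x,y), with 0 ≤ ε ≤ 1/3. Let S ⊆ [n] with |S| = k ∈ {2,3} be such that the Bloch Gram matrix Γ of {ρ^x_1}_{x∈S} (entries Γ_{x,x'} = 2 Re tr(ρ^x_1 ρ^{x'}_1) − 1) is positive definite, let L be the lower-triangular matrix with positive diagonal entries such that Γ = LLᵀ, and assume ‖Γ⁻¹‖·O_k(ε) < 1 where O_k(ε) = 2((k−1)√ε + (k+1)ε). Set F_k(ε) = √ε·√(4k(k−1))·√(1 + 2√ε + ((k+3)/(k−1))ε) and E(ε) = (1/(2√2)) · (‖Γ⁻¹‖ F_k(ε) / √(1 − ‖Γ⁻¹‖ O_k(ε))) · min(‖Γ‖/‖Γ‖_F,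 ‖L‖/√k). Then there exists a 2×2 unitary U such that either (1/k)·∑_{x∈S} Re tr(U ρ̃^x_1 U* ρ^x_1) ≥ 1 − ε(1−2ε)/(1−ε)² − E(ε)², or the same inequality holds with each ρ̃^x_1 replaced by its transpose (ρ̃^x_1)ᵀ in a fixed basis of ℂ². (Theorem 2 in quantitative form, Eq. (23a): average-fidelity robust self-testing bound.) -/

import Mathlib

open Matrix
open scoped ComplexOrder

/-- Operator (spectral) norm of a real matrix, as the norm of the induced
map between Euclidean spaces. -/
noncomputable def opNormR {m n : ℕ} (A : Matrix (Fin m) (Fin n) ℝ) : ℝ :=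
  ‖LinearMap.toContinuousLinearMap (Matrix.toEuclideanLin A)‖

/-- Frobenius norm of a real matrix. -/
noncomputable def frobNorm {m n : ℕ} (A : Matrix (Fin m) (Fin n) ℝ) : ℝ :=
  Real.sqrt (∑ i, ∑ j, (A i j)^2)

/-- A density matrix: positive semidefinite with trace one. -/
def IsDensityMatrix {d : ℕ} (ρ : Matrix (Fin d) (Fin d) ℂ) : Prop :=
  ρ.PosSemidef ∧ ρ.trace = 1

/-- A pure state: a rank-one orthogonal projection (Hermitian, idempotent, trace one). -/
def IsPureState {d : ℕ} (ρ : Matrix (Fin d) (Fin d) ℂ) : Prop :=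
  ρ.IsHermitian ∧ ρ * ρ = ρ ∧ ρ.trace = 1

/-- The function `F_k(ε)` of Theorem 3. -/
noncomputable def Fbound (k : ℕ) (ε : ℝ) : ℝ :=
  Real.sqrt ε * Real.sqrt (4 * (k : ℝ) * ((k : ℝ) - 1)) *
    Real.sqrt (1 + 2 * Real.sqrt ε + (((k : ℝ) + 3) / ((k : ℝ) - 1)) * ε)

/-- The function `O_k(ε)` of Theorem 3. -/
noncomputable def Obound (k : ℕ) (ε : ℝ) : ℝ :=
  2 * (((k : ℝ) - 1) * Real.sqrt ε + ((k : ℝ) + 1) * ε)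

/-- The function `E_{S,k}(ε)` of Theorem 3, built from the Gram matrix `Γ` of
the selected target Bloch vectors and its Cholesky factor `L`. -/
noncomputable def Ebound {k : ℕ} (Γ L : Matrix (Fin k) (Fin k) ℝ) (ε : ℝ) : ℝ :=
  (1 / (2 * Real.sqrt 2)) *
    (opNormR Γ⁻¹ * Fbound k ε / Real.sqrt (1 - opNormR Γ⁻¹ * Obound k ε)) *
    min (opNormR Γ / frobNorm Γ) (opNormR L / Real.sqrt (k : ℝ))

open scoped MatrixOrder in
theorem exists_factor_posSemidef {n : ℕ} {G L : Matrix (Fin n) (Fin n) ℝ} (hG : G.PosSemidef)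
    (hL : IsUnit L.det) : ∃ Y : Matrix (Fin n) (Fin n) ℝ, Yᵀ * Y = G ∧ (L * Y).PosSemidef := by
  have hB : (L⁻¹ * G * (L⁻¹)ᵀ).PosSemidef := by
    simpa using hG.mul_mul_conjTranspose_same L⁻¹
  set Q := CFC.sqrt (L⁻¹ * G * (L⁻¹)ᵀ) with hQ
  have hQ0 : Q.PosSemidef := (CFC.sqrt_nonneg _).posSemidef
  have hQQ : Q * Q = L⁻¹ * G * (L⁻¹)ᵀ := CFC.sqrt_mul_sqrt_self _ hB.nonneg
  have hQt : Qᵀ = Q := by simpa using hQ0.isHermitian.eq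
  refine ⟨Q * Lᵀ, ?_, ?_⟩
  · have h1 : (L⁻¹)ᵀ * Lᵀ = 1 := by
      rw [← transpose_mul, mul_nonsing_inv _ hL, transpose_one]
    calc (Q * Lᵀ)ᵀ * (Q * Lᵀ) = L * (Q * Q) * Lᵀ := by
          rw [transpose_mul, transpose_transpose, hQt]; simp only [Matrix.mul_assoc]
      _ = (L * L⁻¹) * G * ((L⁻¹)ᵀ * Lᵀ) := by rw [hQQ]; simp only [Matrix.mul_assoc]
      _ = G := by rw [mul_nonsing_inv _ hL, h1, Matrix.one_mul, Matrix.mul_one]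
  · simpa [Matrix.mul_assoc] using hQ0.mul_mul_conjTranspose_same L

/-- A lower bound on the singular values of a square matrix holds for its transpose too. -/
theorem mul_dotProduct_self_le_transpose_mulVec {n : ℕ} {W : Matrix (Fin n) (Fin n) ℝ} {c : ℝ}
    (hc : 0 < c) (hW : ∀ v, c * (v ⬝ᵥ v) ≤ (W *ᵥ v) ⬝ᵥ (W *ᵥ v)) (x : Fin n → ℝ) :
    c * (x ⬝ᵥ x) ≤ (Wᵀ *ᵥ x) ⬝ᵥ (Wᵀ *ᵥ x) := by
  have hinj : Function.Injective W.mulVec := by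
    intro a b hab
    have h0 : W *ᵥ (a - b) = 0 := by
      rw [mulVec_sub]; exact sub_eq_zero.2 hab
    have h1 := hW (a - b)
    rw [h0, zero_dotProduct] at h1
    have h2 : 0 ≤ (a - b) ⬝ᵥ (a - b) := by
      simpa using dotProduct_star_self_nonneg (a - b)
    have h3 : (a - b) ⬝ᵥ (a - b) = 0 := by nlinarith
    exact sub_eq_zero.1 (dotProduct_self_eq_zero.1 h3)
  obtain ⟨v, rfl⟩ := (mulVec_surjective_iff_isUnit.2 (mulVec_injective_iff_isUnit.1 hinj)) x
  set y := Wᵀ *ᵥ (W *ᵥ v)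
  have h1 := hW v
  have h2 : (W *ᵥ v) ⬝ᵥ (W *ᵥ v) = v ⬝ᵥ y := by
    rw [dotProduct_comm v, dotProduct_mulVec, ← mulVec_transpose]
  have h3 : 0 ≤ (y - c • v) ⬝ᵥ (y - c • v) := by
    simpa using dotProduct_star_self_nonneg (y - c • v)
  have h4 : (y - c • v) ⬝ᵥ (y - c • v) = y ⬝ᵥ y - 2 * c * (v ⬝ᵥ y) + c ^ 2 * (v ⬝ᵥ v) := by
    simp only [sub_dotProduct, dotProduct_sub, smul_dotProduct, dotProduct_smul, smul_eq_mul,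
      dotProduct_comm y v]
    ring
  rw [h2] at h1 ⊢
  nlinarith

theorem mul_sum_sq_le_of_posSemidef {n : ℕ} {L Y : Matrix (Fin n) (Fin n) ℝ} {c : ℝ} (hc : 0 < c)
    (hLY : (L * Y).PosSemidef)
    (hq : ∀ v : Fin n → ℝ, c * (v ⬝ᵥ v) ≤ v ⬝ᵥ (L * Lᵀ + Yᵀ * Y) *ᵥ v) :
    c * ∑ j, ∑ i, (Y - Lᵀ) i j ^ 2 ≤ ∑ j, ∑ i, (Yᵀ * Y - L * Lᵀ) i j ^ 2 := by
  have hsymm : Yᵀ * Lᵀ = L * Y := by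
    simpa [transpose_mul] using hLY.isHermitian.eq
  have hW : (Y + Lᵀ)ᵀ * (Y + Lᵀ) = (L * Lᵀ + Yᵀ * Y) + (L * Y + L * Y) := by
    rw [transpose_add, transpose_transpose, Matrix.add_mul, Matrix.mul_add, Matrix.mul_add, hsymm]
    abel
  have hD : (Y + Lᵀ)ᵀ * (Y - Lᵀ) = Yᵀ * Y - L * Lᵀ := by
    rw [transpose_add, transpose_transpose, Matrix.add_mul, Matrix.mul_sub, Matrix.mul_sub, hsymm]
    abel
  have hlow : ∀ v, c * (v ⬝ᵥ v) ≤ ((Y + Lᵀ) *ᵥ v) ⬝ᵥ ((Y + Lᵀ) *ᵥ v) := by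
    intro v
    have h1 : ((Y + Lᵀ) *ᵥ v) ⬝ᵥ ((Y + Lᵀ) *ᵥ v) = v ⬝ᵥ ((Y + Lᵀ)ᵀ * (Y + Lᵀ)) *ᵥ v := by
      rw [← mulVec_mulVec, dotProduct_comm v, dotProduct_mulVec, ← mulVec_transpose]
    have h2 : 0 ≤ v ⬝ᵥ (L * Y) *ᵥ v := by simpa using hLY.dotProduct_mulVec_nonneg v
    rw [h1, hW, add_mulVec _ (L * Y + L * Y), add_mulVec (L * Y), dotProduct_add, dotProduct_add]
    have := hq v
    linarith
  rw [Finset.mul_sum, ← hD]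
  refine Finset.sum_le_sum fun j _ => ?_
  have := mul_dotProduct_self_le_transpose_mulVec hc hlow (fun i => (Y - Lᵀ) i j)
  simpa only [dotProduct, mulVec, mul_apply, sq] using this

theorem norm_toEuclideanLin_le {m n : ℕ} (A : Matrix (Fin m) (Fin n) ℝ) (v : Fin n → ℝ) :
    ‖WithLp.toLp 2 (A *ᵥ v)‖ ≤ opNormR A * ‖WithLp.toLp 2 v‖ := by
  simpa [opNormR] using
    (LinearMap.toContinuousLinearMap (Matrix.toEuclideanLin A)).le_opNorm (WithLp.toLp 2 v)

theorem opNormR_nonneg {m n : ℕ} (A : Matrix (Fin m) (Fin n) ℝ) : 0 ≤ opNormR A := norm_nonneg _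

theorem dotProduct_mulVec_le_opNormR {n : ℕ} (A : Matrix (Fin n) (Fin n) ℝ) (v : Fin n → ℝ) :
    v ⬝ᵥ A *ᵥ v ≤ opNormR A * (v ⬝ᵥ v) := by
  have h1 := real_inner_le_norm (WithLp.toLp 2 (A *ᵥ v)) (WithLp.toLp 2 v)
  have h2 := norm_toEuclideanLin_le A v
  have h3 : inner ℝ (WithLp.toLp 2 (A *ᵥ v)) (WithLp.toLp 2 v) = v ⬝ᵥ A *ᵥ v := by
    rw [EuclideanSpace.inner_toLp_toLp]; simp
  have h4 : ‖WithLp.toLp 2 v‖ ^ 2 = v ⬝ᵥ v := by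
    rw [EuclideanSpace.norm_sq_eq]; simp [dotProduct, sq]
  rw [← h4, ← h3]
  nlinarith [norm_nonneg (WithLp.toLp 2 v)]

theorem sum_sq_le_opNormR_sq {m n : ℕ} (A : Matrix (Fin m) (Fin n) ℝ) :
    ∑ i, ∑ j, A i j ^ 2 ≤ n * opNormR A ^ 2 := by
  rw [Finset.sum_comm]
  calc ∑ j, ∑ i, A i j ^ 2 ≤ ∑ _j : Fin n, opNormR A ^ 2 := by
        refine Finset.sum_le_sum fun j _ => ?_
        have h := norm_toEuclideanLin_le A (Pi.single j 1)
        have h1 : ‖WithLp.toLp 2 (Pi.single j (1 : ℝ) : Fin n → ℝ)‖ = 1 :=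
          (PiLp.norm_single 2 (fun _ => ℝ) j (1 : ℝ)).trans (by simp)
        rw [h1, mul_one] at h
        have h2 : ‖WithLp.toLp 2 (A *ᵥ Pi.single j 1)‖ ^ 2 = ∑ i, A i j ^ 2 := by
          rw [EuclideanSpace.norm_sq_eq]; simp
        rw [← h2]
        gcongr
    _ = n * opNormR A ^ 2 := by simp

/-- The smallest eigenvalue of `L * Lᵀ` is bounded below by the inverse norm of the inverse. -/
theorem dotProduct_self_le_opNormR_inv_mul {n : ℕ} {L : Matrix (Fin n) (Fin n) ℝ}
    (hL : IsUnit (L * Lᵀ).det) (v : Fin n → ℝ) :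
    v ⬝ᵥ v ≤ opNormR (L * Lᵀ)⁻¹ * (v ⬝ᵥ (L * Lᵀ) *ᵥ v) := by
  set u := (L * Lᵀ)⁻¹ *ᵥ v with hu
  have huv : (L * Lᵀ) *ᵥ u = v := by
    rw [hu, mulVec_mulVec, mul_nonsing_inv _ hL, one_mulVec]
  have hform : ∀ a b : Fin n → ℝ, a ⬝ᵥ (L * Lᵀ) *ᵥ b = (Lᵀ *ᵥ a) ⬝ᵥ (Lᵀ *ᵥ b) := by
    intro a b
    rw [← mulVec_mulVec, dotProduct_mulVec, ← mulVec_transpose]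
  have hcs : ((Lᵀ *ᵥ v) ⬝ᵥ (Lᵀ *ᵥ u)) ^ 2 ≤
      ((Lᵀ *ᵥ v) ⬝ᵥ (Lᵀ *ᵥ v)) * ((Lᵀ *ᵥ u) ⬝ᵥ (Lᵀ *ᵥ u)) := by
    simpa [dotProduct, sq] using
      Finset.sum_mul_sq_le_sq_mul_sq Finset.univ (Lᵀ *ᵥ v) (Lᵀ *ᵥ u)
  rw [← hform, ← hform, ← hform, huv, dotProduct_comm u v] at hcs
  have h1 : v ⬝ᵥ u ≤ opNormR (L * Lᵀ)⁻¹ * (v ⬝ᵥ v) := dotProduct_mulVec_le_opNormR _ v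
  have h2 : 0 ≤ v ⬝ᵥ v := by simpa using dotProduct_star_self_nonneg v
  have h3 : 0 ≤ v ⬝ᵥ (L * Lᵀ) *ᵥ v := by
    rw [hform]; simpa using dotProduct_star_self_nonneg (Lᵀ *ᵥ v)
  rcases h2.eq_or_lt with h0 | h0
  · rw [← h0]; exact mul_nonneg (opNormR_nonneg _) h3
  · have h4 := mul_le_mul_of_nonneg_left h1 h3
    nlinarith

theorem sum_sum_sq_eq_trace {m n : ℕ} (M : Matrix (Fin m) (Fin n) ℝ) :
    ∑ j, ∑ i, M i j ^ 2 = (Mᵀ * M).trace := by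
  simp [trace, mul_apply, sq]

/-- A quantitative Procrustes bound: a configuration with the Gram matrix of `S` lies close to
the configuration `R` if the Gram matrices are close. -/
theorem exists_gram_eq_and_sum_sq_le {m n : ℕ} {R S : Matrix (Fin m) (Fin n) ℝ}
    {L : Matrix (Fin n) (Fin n) ℝ} (hL : IsUnit L.det) (hR : Rᵀ * R = L * Lᵀ) {c : ℝ} (hc : 0 < c)
    (hq : ∀ v : Fin n → ℝ, c * (v ⬝ᵥ v) ≤ v ⬝ᵥ (L * Lᵀ + Sᵀ * S) *ᵥ v) :
    ∃ Z : Matrix (Fin m) (Fin n) ℝ, Zᵀ * Z = Sᵀ * S ∧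
      c * ∑ j, ∑ i, (Z - R) i j ^ 2 ≤ ∑ j, ∑ i, (Sᵀ * S - L * Lᵀ) i j ^ 2 := by
  have hS : (Sᵀ * S).PosSemidef := by simpa using posSemidef_conjTranspose_mul_self S
  obtain ⟨Y, hY, hLY⟩ := exists_factor_posSemidef hS hL
  have hLt : IsUnit Lᵀ.det := by rwa [det_transpose]
  set H := R * (Lᵀ)⁻¹ with hH
  have hHH : Hᵀ * H = 1 := by
    have h1 : ((Lᵀ)⁻¹)ᵀ = L⁻¹ := by rw [transpose_nonsing_inv, transpose_transpose]
    calc Hᵀ * H = L⁻¹ * (Rᵀ * R) * (Lᵀ)⁻¹ := by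
          rw [hH, transpose_mul, h1]; simp only [Matrix.mul_assoc]
      _ = (L⁻¹ * L) * (Lᵀ * (Lᵀ)⁻¹) := by rw [hR]; simp only [Matrix.mul_assoc]
      _ = 1 := by rw [nonsing_inv_mul _ hL, mul_nonsing_inv _ hLt, Matrix.mul_one]
  have hHL : H * Lᵀ = R := by
    rw [hH, Matrix.mul_assoc, nonsing_inv_mul _ hLt, Matrix.mul_one]
  have hgram : ∀ A : Matrix (Fin n) (Fin n) ℝ, (H * A)ᵀ * (H * A) = Aᵀ * A := by
    intro A
    rw [transpose_mul, Matrix.mul_assoc, ← Matrix.mul_assoc Hᵀ, hHH, Matrix.one_mul]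
  refine ⟨H * Y, by rw [hgram, hY], ?_⟩
  have h2 : H * Y - R = H * (Y - Lᵀ) := by rw [Matrix.mul_sub, hHL]
  rw [sum_sum_sq_eq_trace (H * Y - R), h2, hgram, ← sum_sum_sq_eq_trace]
  have := mul_sum_sq_le_of_posSemidef hc hLY (by rwa [hY])
  rwa [hY] at this

/-- Two linear maps with the same pulled-back norm differ by an isometry of the codomain. -/
theorem exists_linearIsometryEquiv_of_norm_eq {V E : Type*} [AddCommGroup V] [Module ℝ V]
    [NormedAddCommGroup E] [InnerProductSpace ℝ E] [FiniteDimensional ℝ E] (f g : V →ₗ[ℝ] E)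
    (h : ∀ v, ‖f v‖ = ‖g v‖) : ∃ T : E ≃ₗᵢ[ℝ] E, ∀ v, T (f v) = g v := by
  have hker : LinearMap.ker f ≤ LinearMap.ker g := by
    intro v hv
    rw [LinearMap.mem_ker] at hv ⊢
    rw [← norm_eq_zero, ← h, hv, norm_zero]
  let T₀ : LinearMap.range f →ₗ[ℝ] E :=
    (LinearMap.ker f).liftQ g hker ∘ₗ f.quotKerEquivRange.symm.toLinearMap
  have hT₀ : ∀ v, T₀ ⟨f v, LinearMap.mem_range_self f v⟩ = g v := by
    intro v
    have : f.quotKerEquivRange.symm ⟨f v, LinearMap.mem_range_self f v⟩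
        = (LinearMap.ker f).mkQ v := f.quotKerEquivRange_symm_apply_image v _
    simp [T₀, this]
  let T₁ : LinearMap.range f →ₗᵢ[ℝ] E := ⟨T₀, by
    rintro ⟨_, v, rfl⟩
    rw [hT₀, ← h]; rfl⟩
  refine ⟨LinearIsometryEquiv.ofSurjective T₁.extend
    (LinearMap.injective_iff_surjective.1 T₁.extend.injective), fun v => ?_⟩
  exact (T₁.extend_apply ⟨f v, LinearMap.mem_range_self f v⟩).trans (hT₀ v)

theorem exists_linearIsometryEquiv_of_gram_eq {m n : ℕ} {S Z : Matrix (Fin m) (Fin n) ℝ}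
    (h : Zᵀ * Z = Sᵀ * S) :
    ∃ T : EuclideanSpace ℝ (Fin m) ≃ₗᵢ[ℝ] EuclideanSpace ℝ (Fin m),
      ∀ i, T (WithLp.toLp 2 (S.col i)) = WithLp.toLp 2 (Z.col i) := by
  have hnorm : ∀ (A : Matrix (Fin m) (Fin n) ℝ) (v : EuclideanSpace ℝ (Fin n)),
      ‖toEuclideanLin A v‖ ^ 2 = v.ofLp ⬝ᵥ (Aᵀ * A) *ᵥ v.ofLp := by
    intro A v
    rw [EuclideanSpace.norm_sq_eq, ← mulVec_mulVec, dotProduct_mulVec, vecMul_transpose]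
    simp [dotProduct, sq, toLpLin_apply]
  obtain ⟨T, hT⟩ := exists_linearIsometryEquiv_of_norm_eq (toEuclideanLin S) (toEuclideanLin Z)
    (fun v => by
      rw [← sq_eq_sq₀ (norm_nonneg _) (norm_nonneg _), hnorm, hnorm, h])
  refine ⟨T, fun i => ?_⟩
  have := hT (EuclideanSpace.single i 1)
  simpa [toLpLin_apply] using this

theorem abs_dotProduct_mulVec_le {n : ℕ} {D : Matrix (Fin n) (Fin n) ℝ} {a b : ℝ}
    (hoff : ∀ i j, i ≠ j → |D i j| ≤ a) (hdiag : ∀ i, |D i i| ≤ b) (v : Fin n → ℝ) :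
    |v ⬝ᵥ D *ᵥ v| ≤ (((n : ℝ) - 1) * a + b) * (v ⬝ᵥ v) := by
  have hM : ∀ i j, |D i j| ≤ a + if i = j then b - a else 0 := by
    intro i j
    split_ifs with hij
    · subst hij; linarith [hdiag i]
    · linarith [hoff i j hij]
  have h1 : v ⬝ᵥ D *ᵥ v = ∑ i, ∑ j, v i * (D i j * v j) := by
    simp [dotProduct, mulVec, Finset.mul_sum]
  rw [h1]
  calc |∑ i, ∑ j, v i * (D i j * v j)|
      ≤ ∑ i, ∑ j, |v i * (D i j * v j)| :=
        (Finset.abs_sum_le_sum_abs _ _).trans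
          (Finset.sum_le_sum fun i _ => Finset.abs_sum_le_sum_abs _ _)
    _ ≤ ∑ i, ∑ j, (a + if i = j then b - a else 0) * ((v i ^ 2 + v j ^ 2) / 2) := by
        refine Finset.sum_le_sum fun i _ => Finset.sum_le_sum fun j _ => ?_
        have h2 : |v i| * |v j| ≤ (v i ^ 2 + v j ^ 2) / 2 := by
          nlinarith [sq_nonneg (|v i| - |v j|), sq_abs (v i), sq_abs (v j)]
        calc |v i * (D i j * v j)| = |D i j| * (|v i| * |v j|) := by
              rw [abs_mul, abs_mul]; ring
          _ ≤ |D i j| * ((v i ^ 2 + v j ^ 2) / 2) := by gcongr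
          _ ≤ _ := by gcongr; exact hM i j
    _ = (((n : ℝ) - 1) * a + b) * (v ⬝ᵥ v) := by
        simp only [add_mul, ite_mul, zero_mul, Finset.sum_add_distrib, Finset.sum_ite_eq,
          Finset.mem_univ, if_true, ← Finset.mul_sum, dotProduct, add_div, Finset.sum_const,
          Finset.card_univ, Fintype.card_fin, nsmul_eq_mul, ← Finset.sum_div, ← sq]
        ring

theorem sum_sq_le_of_abs_le {n : ℕ} {D : Matrix (Fin n) (Fin n) ℝ} {a b : ℝ}
    (hoff : ∀ i j, i ≠ j → |D i j| ≤ a) (hdiag : ∀ i, |D i i| ≤ b) :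
    ∑ j, ∑ i, D i j ^ 2 ≤ n * ((n : ℝ) - 1) * a ^ 2 + n * b ^ 2 := by
  have hM : ∀ i j, D i j ^ 2 ≤ a ^ 2 + if i = j then b ^ 2 - a ^ 2 else 0 := by
    intro i j
    split_ifs with hij
    · subst hij
      have := pow_le_pow_left₀ (abs_nonneg _) (hdiag i) 2
      rw [sq_abs] at this; linarith
    · have := pow_le_pow_left₀ (abs_nonneg _) (hoff i j hij) 2
      rw [sq_abs] at this; linarith
  refine (Finset.sum_le_sum fun j _ => Finset.sum_le_sum fun i _ => hM i j).trans_eq ?_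
  simp only [Finset.sum_add_distrib, Finset.sum_ite_eq', Finset.mem_univ, if_true,
    Finset.sum_const, Finset.card_univ, Fintype.card_fin, nsmul_eq_mul]
  ring

/-- The Hermitian matrix `(p + r · σ) / 2` with trace `p` and Bloch vector `r`. -/
noncomputable def blochMatrix (p : ℝ) (r : EuclideanSpace ℝ (Fin 3)) :
    Matrix (Fin 2) (Fin 2) ℂ :=
  !![((p : ℂ) + r 2) / 2, ((r 0 : ℂ) - Complex.I * r 1) / 2;
    ((r 0 : ℂ) + Complex.I * r 1) / 2, ((p : ℂ) - r 2) / 2]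

theorem inner_eq_sum_three (r s : EuclideanSpace ℝ (Fin 3)) :
    inner ℝ r s = r 0 * s 0 + r 1 * s 1 + r 2 * s 2 := by
  simp [PiLp.inner_apply, Fin.sum_univ_three]; ring

theorem Matrix.IsHermitian.exists_eq_blochMatrix {X : Matrix (Fin 2) (Fin 2) ℂ}
    (hX : X.IsHermitian) : ∃ p r, X = blochMatrix p r := by
  have h00 := congrArg Complex.im (hX.apply 0 0)
  have h11 := congrArg Complex.im (hX.apply 1 1)
  have h01 := hX.apply 1 0
  simp only [RCLike.star_def, Complex.conj_im] at h00 h11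
  refine ⟨(X 0 0 + X 1 1).re,
    !₂[2 * (X 0 1).re, -2 * (X 0 1).im, (X 0 0 - X 1 1).re], ?_⟩
  ext i j
  fin_cases i <;> fin_cases j <;> apply Complex.ext <;>
    simp [blochMatrix, ← h01] <;> linarith

theorem trace_blochMatrix (p : ℝ) (r : EuclideanSpace ℝ (Fin 3)) :
    (blochMatrix p r).trace = p := by
  simp [blochMatrix, trace_fin_two]; ring

theorem re_trace_blochMatrix_mul (p q : ℝ) (r s : EuclideanSpace ℝ (Fin 3)) :
    (blochMatrix p r * blochMatrix q s).trace.re = (p * q + inner ℝ r s) / 2 := by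
  simp [blochMatrix, trace_fin_two, inner_eq_sum_three]; ring

theorem one_sub_blochMatrix (p : ℝ) (r : EuclideanSpace ℝ (Fin 3)) :
    1 - blochMatrix p r = blochMatrix (2 - p) (-r) := by
  ext i j
  fin_cases i <;> fin_cases j <;> simp [blochMatrix] <;> ring

theorem norm_le_of_posSemidef_blochMatrix {p : ℝ} {r : EuclideanSpace ℝ (Fin 3)}
    (h : (blochMatrix p r).PosSemidef) : ‖r‖ ≤ p := by
  have htr : 0 ≤ p := by
    have := h.trace_nonneg
    rwa [trace_blochMatrix, Complex.zero_le_real] at this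
  have hdet : (blochMatrix p r).det = (((p ^ 2 - ‖r‖ ^ 2) / 4 : ℝ) : ℂ) := by
    rw [← real_inner_self_eq_norm_sq, inner_eq_sum_three, det_fin_two]
    apply Complex.ext <;> simp [blochMatrix, sq] <;> ring
  have h1 := h.det_nonneg
  rw [hdet, Complex.zero_le_real] at h1
  exact abs_le_of_sq_le_sq' (by linarith) htr |>.2

theorem IsDensityMatrix.exists_eq_blochMatrix {X : Matrix (Fin 2) (Fin 2) ℂ}
    (hX : IsDensityMatrix X) : ∃ r, X = blochMatrix 1 r ∧ ‖r‖ ≤ 1 := by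
  obtain ⟨p, r, rfl⟩ := hX.1.isHermitian.exists_eq_blochMatrix
  have hp : p = 1 := by
    have := hX.2; rw [trace_blochMatrix] at this; exact_mod_cast this
  subst hp
  exact ⟨r, rfl, norm_le_of_posSemidef_blochMatrix hX.1⟩

theorem IsPureState.exists_eq_blochMatrix {X : Matrix (Fin 2) (Fin 2) ℂ}
    (hX : IsPureState X) : ∃ r, X = blochMatrix 1 r ∧ ‖r‖ = 1 := by
  obtain ⟨p, r, rfl⟩ := hX.1.exists_eq_blochMatrix
  have hp : p = 1 := by
    have := hX.2.2; rw [trace_blochMatrix] at this; exact_mod_cast this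
  subst hp
  refine ⟨r, rfl, ?_⟩
  have h := re_trace_blochMatrix_mul 1 1 r r
  rw [hX.2.1, hX.2.2, real_inner_self_eq_norm_sq, Complex.one_re] at h
  exact (sq_eq_sq₀ (norm_nonneg r) zero_le_one).1 (by linarith)

/-- Spin flip: the second Pauli matrix composed with transposition inverts the Bloch vector. -/
theorem pauliY_mul_transpose_blochMatrix_mul (p : ℝ) (r : EuclideanSpace ℝ (Fin 3)) :
    !![0, -Complex.I; Complex.I, 0] * (blochMatrix p r)ᵀ * !![0, -Complex.I; Complex.I, 0]
      = blochMatrix p (-r) := by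
  have htr : (blochMatrix p r)ᵀ = !![((p : ℂ) + r 2) / 2, ((r 0 : ℂ) + Complex.I * r 1) / 2;
      ((r 0 : ℂ) - Complex.I * r 1) / 2, ((p : ℂ) - r 2) / 2] := by
    ext i j; fin_cases i <;> fin_cases j <;> rfl
  rw [htr]
  ext i j
  fin_cases i <;> fin_cases j <;> apply Complex.ext <;> simp [blochMatrix, mul_apply] <;> ring

theorem blochMatrix_zero_conj (p : ℝ) (v r : EuclideanSpace ℝ (Fin 3)) :
    blochMatrix 0 ((2 : ℝ) • v) * blochMatrix p r * blochMatrix 0 ((2 : ℝ) • v)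
      = blochMatrix (‖v‖ ^ 2 * p) ((2 * inner ℝ v r) • v - ‖v‖ ^ 2 • r) := by
  rw [← real_inner_self_eq_norm_sq, inner_eq_sum_three, inner_eq_sum_three]
  ext i j
  fin_cases i <;> fin_cases j <;> apply Complex.ext <;> simp [blochMatrix, mul_apply] <;> ring

/-- `T` is implemented on Bloch vectors by conjugating with a unitary, possibly after
transposition. -/
def IsImplementedByUnitary
    (T : EuclideanSpace ℝ (Fin 3) ≃ₗᵢ[ℝ] EuclideanSpace ℝ (Fin 3)) : Prop :=
  ∃ U ∈ Matrix.unitaryGroup (Fin 2) ℂ,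
    (∀ p r, U * blochMatrix p r * Uᴴ = blochMatrix p (T r)) ∨
    (∀ p r, U * (blochMatrix p r)ᵀ * Uᴴ = blochMatrix p (T r))

theorem isImplementedByUnitary_one : IsImplementedByUnitary 1 :=
  ⟨1, one_mem _, Or.inl fun p r => by simp⟩

theorem IsImplementedByUnitary.mul
    {T T' : EuclideanSpace ℝ (Fin 3) ≃ₗᵢ[ℝ] EuclideanSpace ℝ (Fin 3)}
    (h : IsImplementedByUnitary T) (h' : IsImplementedByUnitary T') :
    IsImplementedByUnitary (T * T') := by
  obtain ⟨U, hU, h⟩ := h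
  obtain ⟨V, hV, h'⟩ := h'
  have hconj : (Vᴴᵀ)ᴴ = Vᵀ := by ext i j; simp
  have hstar : Vᴴᵀ ∈ Matrix.unitaryGroup (Fin 2) ℂ := by
    have h1 := congrArg transpose (Matrix.mem_unitaryGroup_iff'.1 hV)
    rw [star_eq_conjTranspose, transpose_mul, transpose_one] at h1
    rwa [Matrix.mem_unitaryGroup_iff', star_eq_conjTranspose, hconj]
  have htr : ∀ X : Matrix (Fin 2) (Fin 2) ℂ, Vᴴᵀ * Xᵀ * (Vᴴᵀ)ᴴ = (V * X * Vᴴ)ᵀ := by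
    intro X; rw [hconj]; simp only [transpose_mul, Matrix.mul_assoc]
  rcases h with h | h <;> rcases h' with h' | h'
  · refine ⟨U * V, mul_mem hU hV, Or.inl fun p r => ?_⟩
    calc _ = U * (V * blochMatrix p r * Vᴴ) * Uᴴ := by
          simp only [conjTranspose_mul, Matrix.mul_assoc]
      _ = _ := by rw [h', h]; rfl
  · refine ⟨U * V, mul_mem hU hV, Or.inr fun p r => ?_⟩
    calc _ = U * (V * (blochMatrix p r)ᵀ * Vᴴ) * Uᴴ := by
          simp only [conjTranspose_mul, Matrix.mul_assoc]
      _ = _ := by rw [h', h]; rfl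
  · refine ⟨U * Vᴴᵀ, mul_mem hU hstar, Or.inr fun p r => ?_⟩
    calc _ = U * (Vᴴᵀ * (blochMatrix p r)ᵀ * (Vᴴᵀ)ᴴ) * Uᴴ := by
          simp only [conjTranspose_mul, Matrix.mul_assoc]
      _ = _ := by rw [htr, h', h]; rfl
  · refine ⟨U * Vᴴᵀ, mul_mem hU hstar, Or.inl fun p r => ?_⟩
    calc _ = U * (Vᴴᵀ * (blochMatrix p r)ᵀᵀ * (Vᴴᵀ)ᴴ) * Uᴴ := by
          simp only [conjTranspose_mul, Matrix.mul_assoc, transpose_transpose]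
      _ = _ := by rw [htr, h', h]; rfl

theorem isImplementedByUnitary_reflection (v : EuclideanSpace ℝ (Fin 3)) :
    IsImplementedByUnitary (ℝ ∙ v)ᗮ.reflection := by
  rcases eq_or_ne v 0 with rfl | hv
  · convert isImplementedByUnitary_one
    ext1 r
    exact Submodule.reflection_mem_subspace_eq_self (by simp)
  have hv' : ‖v‖ ≠ 0 := norm_ne_zero_iff.2 hv
  set w := ‖v‖⁻¹ • v with hw
  have hw1 : ‖w‖ = 1 := by rw [hw, norm_smul, norm_inv, norm_norm, inv_mul_cancel₀ hv']
  have hrefl : ∀ r, (ℝ ∙ v)ᗮ.reflection r = r - (2 * inner ℝ w r) • w := by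
    intro r
    rw [Submodule.reflection_orthogonal_apply, Submodule.reflection_singleton_apply, hw,
      real_inner_smul_left, smul_smul, ← Nat.cast_smul_eq_nsmul ℝ, smul_smul, neg_sub]
    congr 2
    simp only [RCLike.ofReal_real_eq_id, id]
    field_simp
    norm_num [mul_comm]
  set Y : Matrix (Fin 2) (Fin 2) ℂ := !![0, -Complex.I; Complex.I, 0] with hY
  set N := blochMatrix 0 ((2 : ℝ) • w) with hN
  have hYH : Yᴴ = Y := by
    ext i j; fin_cases i <;> fin_cases j <;> simp [hY]
  have hYY : Y * Y = 1 := by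
    ext i j; fin_cases i <;> fin_cases j <;> simp [hY]
  have hNH : Nᴴ = N := by
    ext i j; fin_cases i <;> fin_cases j <;> simp [hN, blochMatrix, Complex.ext_iff]
  have hone : (1 : Matrix (Fin 2) (Fin 2) ℂ) = blochMatrix 2 0 := by
    ext i j; fin_cases i <;> fin_cases j <;> simp [blochMatrix]
  have hNN : N * N = 1 := by
    have := blochMatrix_zero_conj 2 w 0
    rw [← hone, hw1] at this
    simpa [← hone] using this
  refine ⟨N * Y, ?_, Or.inr fun p r => ?_⟩
  · rw [Matrix.mem_unitaryGroup_iff, star_eq_conjTranspose, conjTranspose_mul, hYH, hNH,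
      Matrix.mul_assoc, ← Matrix.mul_assoc Y, hYY, Matrix.one_mul, hNN]
  · calc N * Y * (blochMatrix p r)ᵀ * (N * Y)ᴴ = N * (Y * (blochMatrix p r)ᵀ * Y) * N := by
          rw [conjTranspose_mul, hYH, hNH]; simp only [Matrix.mul_assoc]
      _ = _ := by
          rw [pauliY_mul_transpose_blochMatrix_mul, blochMatrix_zero_conj, hw1, hrefl,
            inner_neg_right]
          congr 1 <;> simp
          abel

/-- Every isometry of the Bloch ball fixing the origin is a unitary or antiunitary conjugation. -/
theorem isImplementedByUnitary_all
    (T : EuclideanSpace ℝ (Fin 3) ≃ₗᵢ[ℝ] EuclideanSpace ℝ (Fin 3)) : IsImplementedByUnitary T := by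
  obtain ⟨l, -, rfl⟩ := T.reflections_generate_dim
  induction l with
  | nil => exact isImplementedByUnitary_one
  | cons v l ih => exact (isImplementedByUnitary_reflection v).mul ih

section Statistics

variable {E : Type*} [NormedAddCommGroup E] [InnerProductSpace ℝ E] {s s' m : E} {c ε : ℝ}

/-- An effect `(1 + c + m · σ) / 2` that nearly discriminates two states is nearly unbiased. -/
theorem abs_bias_le (hs : ‖s‖ ≤ 1) (hs' : ‖s'‖ ≤ 1) (hm : ‖m‖ ≤ 1 - |c|)
    (h : 1 - 2 * ε ≤ c + inner ℝ s m) (h' : 1 - 2 * ε ≤ -c - inner ℝ s' m) : |c| ≤ ε := by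
  have h1 := real_inner_le_norm s m
  have h2 := neg_le_of_abs_le (abs_real_inner_le_norm s' m)
  have h3 := mul_le_of_le_one_left (norm_nonneg m) hs
  have h4 := mul_le_of_le_one_left (norm_nonneg m) hs'
  rcases abs_cases c with ⟨hc, _⟩ | ⟨hc, _⟩ <;> rw [hc] at hm ⊢ <;> linarith

theorem le_norm_mul_of_discriminated (hs : ‖s‖ ≤ 1) (hs' : ‖s'‖ ≤ 1) (hm : ‖m‖ ≤ 1 - |c|)
    (h : 1 - 2 * ε ≤ c + inner ℝ s m) (h' : 1 - 2 * ε ≤ -c - inner ℝ s' m) :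
    1 - 3 * ε ≤ ‖s‖ * (1 - ε) := by
  have hc := abs_bias_le hs hs' hm h h'
  have h1 := real_inner_le_norm s m
  have h2 := mul_le_mul_of_nonneg_left hm (norm_nonneg s)
  have h3 := norm_nonneg s
  rcases abs_cases c with ⟨hc', hc0⟩ | ⟨hc', hc0⟩ <;> rw [hc'] at hm h2 hc
  · nlinarith
  · have : 1 - 2 * ε ≤ ‖s‖ := by nlinarith
    nlinarith [sq_nonneg ε]

theorem abs_inner_sub_le_of_discriminated {u : E} {g t : ℝ} (hs : ‖s‖ ≤ 1) (hs' : ‖s'‖ ≤ 1)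
    (hu : ‖u‖ ≤ 1) (hm : ‖m‖ ≤ 1 - |c|) (h : 1 - 2 * ε ≤ c + inner ℝ s m)
    (h' : 1 - 2 * ε ≤ -c - inner ℝ s' m) (ht : 0 ≤ t) (hε : ε = t ^ 2)
    (hg : |c + inner ℝ u m - g| ≤ 2 * ε) :
    |inner ℝ u s - g| ≤ (1 + t / 2) * (2 * (t + t ^ 2)) := by
  have hc := abs_bias_le hs hs' hm h h'
  have hc2 : c ^ 2 ≤ (t ^ 2) ^ 2 := by
    rw [← sq_abs c, ← hε]; exact pow_le_pow_left₀ (abs_nonneg c) hc 2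
  have hd : ‖s - m‖ ≤ 2 * t + t ^ 3 := by
    have h1 := norm_sub_sq_real s m
    have h2 : ‖s‖ ^ 2 ≤ 1 := by nlinarith [norm_nonneg s]
    have h3 : ‖m‖ ^ 2 ≤ (1 - |c|) ^ 2 := pow_le_pow_left₀ (norm_nonneg m) hm 2
    have h4 := le_abs_self c
    refine abs_le_of_sq_le_sq' ?_ (by positivity) |>.2
    have h5 : ‖s - m‖ ^ 2 ≤ 4 * t ^ 2 + c ^ 2 := by
      rw [hε] at h
      nlinarith [sq_abs c]
    nlinarith [pow_nonneg ht 6, pow_nonneg ht 4]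
  have hud : |inner ℝ u (s - m)| ≤ 2 * t + t ^ 3 :=
    (abs_real_inner_le_norm u (s - m)).trans
      ((mul_le_of_le_one_left (norm_nonneg _) hu).trans hd)
  rw [inner_sub_right] at hud
  rw [hε] at hc hg
  rw [abs_le] at *
  constructor <;> nlinarith

end Statistics

theorem Obound_eq (k : ℕ) {ε : ℝ} (hε : 0 ≤ ε) : Obound k ε =
    ((k : ℝ) - 1) * (2 * (√ε + √ε ^ 2)) + 4 * √ε ^ 2 := by
  rw [Obound, Real.sq_sqrt hε]; ring

theorem Fbound_sq {k : ℕ} (hk : 2 ≤ k) {ε : ℝ} (hε : 0 ≤ ε) : Fbound k ε ^ 2 =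
    k * ((k : ℝ) - 1) * (2 * (√ε + √ε ^ 2)) ^ 2 + k * (4 * √ε ^ 2) ^ 2 := by
  have hk' : (2 : ℝ) ≤ k := by exact_mod_cast hk
  have hk1 : 0 < (k : ℝ) - 1 := by linarith
  rw [Fbound, mul_pow, mul_pow, Real.sq_sqrt (by positivity : (0 : ℝ) ≤ 4 * k * ((k : ℝ) - 1)),
    Real.sq_sqrt (by positivity :
      (0 : ℝ) ≤ 1 + 2 * √ε + (((k : ℝ) + 3) / ((k : ℝ) - 1)) * ε)]
  nth_rewrite 3 [← Real.sq_sqrt hε]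
  field_simp
  ring

theorem div_le_Ebound_sq {k : ℕ} (hk : 0 < k) {ε : ℝ} {Γ L : Matrix (Fin k) (Fin k) ℝ}
    (hΓ : ∀ i, Γ i i = 1) (hΓL : Γ = L * Lᵀ) (hsmall : opNormR Γ⁻¹ * Obound k ε < 1) :
    opNormR Γ⁻¹ ^ 2 * Fbound k ε ^ 2 / (8 * k * (1 - opNormR Γ⁻¹ * Obound k ε))
      ≤ Ebound Γ L ε ^ 2 := by
  have hk' : (0 : ℝ) < k := by exact_mod_cast hk
  have hsk : 0 < √(k : ℝ) := Real.sqrt_pos.2 hk'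
  have h1 : 1 / √(k : ℝ) ≤ opNormR Γ / frobNorm Γ := by
    have hpos : 0 < ∑ i, ∑ j, Γ i j ^ 2 := by
      refine Finset.sum_pos (fun i _ => ?_) (Finset.univ_nonempty_iff.2 ⟨⟨0, hk⟩⟩)
      exact Finset.sum_pos' (fun j _ => sq_nonneg _) ⟨i, Finset.mem_univ i, by simp [hΓ]⟩
    rw [frobNorm, div_le_div_iff₀ hsk (Real.sqrt_pos.2 hpos), one_mul]
    refine (Real.sqrt_le_sqrt (sum_sq_le_opNormR_sq Γ)).trans ?_
    rw [Real.sqrt_mul hk'.le, Real.sqrt_sq (opNormR_nonneg _), mul_comm]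
  have h2 : 1 / √(k : ℝ) ≤ opNormR L / √(k : ℝ) := by
    gcongr
    have hsum : ∑ i, ∑ j, L i j ^ 2 = k := by
      have : ∀ i, ∑ j, L i j ^ 2 = 1 := fun i => by
        rw [← hΓ i, hΓL]; simp [mul_apply, sq]
      simp [this]
    have h3 := sum_sq_le_opNormR_sq L
    rw [hsum] at h3
    have h4 : 1 ≤ opNormR L ^ 2 := by
      by_contra! h
      nlinarith
    exact (one_le_sq_iff₀ (opNormR_nonneg L)).1 h4
  have h3 : (1 / √(k : ℝ)) ^ 2 ≤
      (min (opNormR Γ / frobNorm Γ) (opNormR L / √(k : ℝ))) ^ 2 :=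
    pow_le_pow_left₀ (by positivity) (le_min h1 h2) 2
  have h4 : 0 < 1 - opNormR Γ⁻¹ * Obound k ε := by linarith
  rw [Ebound, mul_pow, mul_pow, div_pow, div_pow, mul_pow, mul_pow, Real.sq_sqrt h4.le,
    Real.sq_sqrt zero_le_two]
  refine le_trans (le_of_eq ?_) (mul_le_mul_of_nonneg_left h3 (by positivity))
  rw [div_pow, Real.sq_sqrt hk'.le]
  field_simp
  norm_num

theorem procrustes_constant_le {ν o q t : ℝ} (ht : 0 ≤ t) (hq : q = 1 + t / 2) (ht2 : t ≤ 2)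
    (hν : 1 ≤ ν) (ho : 2 * t + 2 * t ^ 2 ≤ o) (hνo : ν * o < 1) :
    2 * q ^ 2 * (1 - ν * o) ≤ ν ^ 2 * (2 / ν - q * o) := by
  have ho0 : 0 ≤ o := le_trans (by positivity) ho
  have h0 : ν ^ 2 * (2 / ν - q * o) = ν * ((2 - q) + q * (1 - ν * o)) := by
    field_simp; ring
  have hx : 1 - ν * o ≤ 1 - o := by nlinarith
  have hx0 : 0 < 1 - ν * o := by linarith
  have hqx : 0 ≤ (2 - q) + q * (1 - ν * o) :=
    add_nonneg (by linarith) (mul_nonneg (by linarith) hx0.le)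
  have hqq : 0 ≤ 2 * q ^ 2 - q := by rw [hq]; nlinarith
  have h1 : (2 * q ^ 2 - q) * (1 - ν * o) ≤ (2 * q ^ 2 - q) * (1 - o) :=
    mul_le_mul_of_nonneg_left hx hqq
  have h2 : (2 * q ^ 2 - q) * (2 * t + 2 * t ^ 2) ≤ (2 * q ^ 2 - q) * o :=
    mul_le_mul_of_nonneg_left ho hqq
  have h3 : 2 * q ^ 2 - 2 ≤ (2 * q ^ 2 - q) * (2 * t + 2 * t ^ 2) := by
    rw [hq]
    nlinarith [pow_nonneg ht 2, pow_nonneg ht 3, pow_nonneg ht 4]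
  rw [h0]
  nlinarith

/-- The Procrustes bound specialised to unit vectors whose Gram matrix is perturbed entrywise by
at most `1 + √ε / 2` times the entries underlying `Fbound` and `Obound`. -/
theorem exists_linearIsometryEquiv_sum_sq_le {k : ℕ} (hk : 2 ≤ k) {ε : ℝ} (hε0 : 0 ≤ ε)
    (hε1 : ε ≤ 1) {r s : Fin k → EuclideanSpace ℝ (Fin 3)} {Γ L : Matrix (Fin k) (Fin k) ℝ}
    (hr : ∀ i, ‖r i‖ = 1) (hΓ : ∀ i j, Γ i j = inner ℝ (r i) (r j)) (hΓpd : Γ.PosDef)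
    (hΓL : Γ = L * Lᵀ) (hsmall : opNormR Γ⁻¹ * Obound k ε < 1)
    (hoff : ∀ i j, i ≠ j →
      |inner ℝ (s i) (s j) - inner ℝ (r i) (r j)| ≤ (1 + √ε / 2) * (2 * (√ε + √ε ^ 2)))
    (hdiag : ∀ i, |‖s i‖ ^ 2 - 1| ≤ (1 + √ε / 2) * (4 * √ε ^ 2)) :
    ∃ T : EuclideanSpace ℝ (Fin 3) ≃ₗᵢ[ℝ] EuclideanSpace ℝ (Fin 3),
      ∑ i, ‖T (s i) - r i‖ ^ 2 ≤ 4 * k * Ebound Γ L ε ^ 2 := by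
  have hk' : (2 : ℝ) ≤ k := by exact_mod_cast hk
  have ht : 0 ≤ √ε := Real.sqrt_nonneg ε
  have ht1 : √ε ≤ 1 := Real.sqrt_le_one.2 hε1
  have hΓ1 : ∀ i, Γ i i = 1 := fun i => by rw [hΓ, real_inner_self_eq_norm_sq, hr]; norm_num
  have hE := div_le_Ebound_sq (by omega) hΓ1 hΓL hsmall
  have hdetΓ : IsUnit Γ.det := hΓpd.det_pos.ne'.isUnit
  have hdetL : IsUnit L.det := by
    rw [hΓL, det_mul] at hdetΓ
    exact isUnit_of_mul_isUnit_left hdetΓ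
  have hO := Obound_eq k hε0
  have hF := Fbound_sq hk hε0
  have hlow : ∀ v : Fin k → ℝ, v ⬝ᵥ v ≤ opNormR Γ⁻¹ * (v ⬝ᵥ Γ *ᵥ v) := by
    rw [hΓL] at hdetΓ ⊢
    exact dotProduct_self_le_opNormR_inv_mul hdetΓ
  have hν : 1 ≤ opNormR Γ⁻¹ := by
    have := hlow (Pi.single ⟨0, by omega⟩ 1)
    simpa [hΓ1] using this
  set ν := opNormR Γ⁻¹
  set o := Obound k ε
  set t := √ε
  obtain ⟨q, hq⟩ : ∃ q, q = 1 + t / 2 := ⟨_, rfl⟩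
  rw [← hq] at hoff hdiag
  have hconst : 2 * q ^ 2 * (1 - ν * o) ≤ ν ^ 2 * (2 / ν - q * o) := by
    refine procrustes_constant_le ht hq (by linarith) hν ?_ hsmall
    rw [hO]
    nlinarith [mul_nonneg (sub_nonneg.2 hk') (add_nonneg ht (sq_nonneg t)), sq_nonneg t]
  have hx0 : 0 < 1 - ν * o := by linarith
  have hc : 0 < 2 / ν - q * o := by
    have : 0 < ν ^ 2 * (2 / ν - q * o) := lt_of_lt_of_le (by rw [hq]; positivity) hconst
    exact pos_of_mul_pos_right this (by positivity)
  let R : Matrix (Fin 3) (Fin k) ℝ := of fun a i => r i a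
  let S : Matrix (Fin 3) (Fin k) ℝ := of fun a i => s i a
  have hR : Rᵀ * R = L * Lᵀ := by
    rw [← hΓL]; ext i j
    simp [R, mul_apply, hΓ, inner_eq_sum_three, Fin.sum_univ_three]
  have hD : ∀ i j, (Sᵀ * S - L * Lᵀ) i j = inner ℝ (s i) (s j) - inner ℝ (r i) (r j) := by
    intro i j
    rw [← hΓL, Matrix.sub_apply, hΓ]
    simp [S, mul_apply, inner_eq_sum_three, Fin.sum_univ_three]
  have hDoff : ∀ i j, i ≠ j → |(Sᵀ * S - L * Lᵀ) i j| ≤ q * (2 * (t + t ^ 2)) := by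
    intro i j hij; rw [hD]; exact hoff i j hij
  have hDdiag : ∀ i, |(Sᵀ * S - L * Lᵀ) i i| ≤ q * (4 * t ^ 2) := by
    intro i
    rw [hD, real_inner_self_eq_norm_sq, real_inner_self_eq_norm_sq, hr, one_pow]
    exact hdiag i
  have hquad : ∀ v : Fin k → ℝ,
      (2 / ν - q * o) * (v ⬝ᵥ v) ≤ v ⬝ᵥ (L * Lᵀ + Sᵀ * S) *ᵥ v := by
    intro v
    have h1 := (abs_le.1 (abs_dotProduct_mulVec_le hDoff hDdiag v)).1
    have h2 : v ⬝ᵥ (L * Lᵀ + Sᵀ * S) *ᵥ v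
        = 2 * (v ⬝ᵥ Γ *ᵥ v) + v ⬝ᵥ (Sᵀ * S - L * Lᵀ) *ᵥ v := by
      rw [← hΓL, add_mulVec, sub_mulVec, dotProduct_add, dotProduct_sub]; ring
    have h3 : 2 / ν * (v ⬝ᵥ v) ≤ 2 * (v ⬝ᵥ Γ *ᵥ v) := by
      rw [div_mul_eq_mul_div, div_le_iff₀ (by linarith)]
      linarith [hlow v]
    have h4 : ((k : ℝ) - 1) * (q * (2 * (t + t ^ 2))) + q * (4 * t ^ 2) = q * o := by
      rw [hO]; ring
    rw [h4] at h1
    rw [h2, sub_mul]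
    linarith
  obtain ⟨Z, hZ, hZR⟩ := exists_gram_eq_and_sum_sq_le hdetL hR hc hquad
  obtain ⟨T, hT⟩ := exists_linearIsometryEquiv_of_gram_eq hZ
  refine ⟨T, ?_⟩
  have hsum : ∑ i, ‖T (s i) - r i‖ ^ 2 = ∑ j, ∑ i, (Z - R) i j ^ 2 := by
    refine Finset.sum_congr rfl fun j _ => ?_
    have h1 : T (s j) = WithLp.toLp 2 (Z.col j) := hT j
    rw [h1, EuclideanSpace.norm_sq_eq]
    simp [R]
  have hFrob : (2 / ν - q * o) * ∑ i, ‖T (s i) - r i‖ ^ 2 ≤ q ^ 2 * Fbound k ε ^ 2 := by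
    rw [hsum, hF]
    refine hZR.trans ((sum_sq_le_of_abs_le hDoff hDdiag).trans_eq ?_)
    ring
  set X := ∑ i, ‖T (s i) - r i‖ ^ 2
  have hX0 : 0 ≤ X := Finset.sum_nonneg fun i _ => sq_nonneg _
  have hXF : 2 * (1 - ν * o) * X ≤ ν ^ 2 * Fbound k ε ^ 2 := by
    have h1 := mul_le_mul_of_nonneg_right hconst hX0
    have h2 := mul_le_mul_of_nonneg_left hFrob (sq_nonneg ν)
    have hq0 : 0 < q ^ 2 := by rw [hq]; positivity
    refine le_of_mul_le_mul_left ?_ hq0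
    linarith
  calc X ≤ 4 * k * (ν ^ 2 * Fbound k ε ^ 2 / (8 * k * (1 - ν * o))) := by
        have : 4 * k * (ν ^ 2 * Fbound k ε ^ 2 / (8 * k * (1 - ν * o)))
            = ν ^ 2 * Fbound k ε ^ 2 / (2 * (1 - ν * o)) := by
          field_simp; ring
        rw [this, le_div_iff₀ (by linarith)]
        linarith
    _ ≤ _ := by gcongr

/-- Theorem 2 in quantitative form, Eq. (23a): average-fidelity robust
self-testing bound for the states of the linearly independent subset `S`. -/
theorem robust_selftesting_average_fidelity (n k : ℕ) (hk : k = 2 ∨ k = 3)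
    (ε : ℝ) (hε0 : 0 ≤ ε) (hε : ε ≤ 1/3)
    (ρ ρt Mt : Fin n → Fin 2 → Matrix (Fin 2) (Fin 2) ℂ)
    (hρ : ∀ x a, IsPureState (ρ x a))
    (hρsum : ∀ x, ρ x 0 + ρ x 1 = 1)
    (hρt : ∀ x a, IsDensityMatrix (ρt x a))
    (hMt : ∀ y b, (Mt y b).PosSemidef)
    (hMtsum : ∀ y, Mt y 0 + Mt y 1 = 1)
    (hstat : ∀ x y a b,
      |((ρt x a * Mt y b).trace).re - ((ρ x a * ρ y b).trace).re| ≤ ε)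
    (S : Fin k ↪ Fin n)
    (Γ L : Matrix (Fin k) (Fin k) ℝ)
    (hΓ : ∀ i j, Γ i j = 2 * ((ρ (S i) 0 * ρ (S j) 0).trace).re - 1)
    (hΓpd : Γ.PosDef)
    (hLtri : ∀ i j : Fin k, i < j → L i j = 0)
    (hLdiag : ∀ i, 0 < L i i)
    (hChol : Γ = L * Lᵀ)
    (hsmall : opNormR Γ⁻¹ * Obound k ε < 1) :
    ∃ U : Matrix (Fin 2) (Fin 2) ℂ, U ∈ Matrix.unitaryGroup (Fin 2) ℂ ∧
      (1 - ε * (1 - 2 * ε) / (1 - ε)^2 - (Ebound Γ L ε)^2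
          ≤ (1 / (k : ℝ)) * ∑ i, ((U * ρt (S i) 0 * Uᴴ * ρ (S i) 0).trace).re ∨
       1 - ε * (1 - 2 * ε) / (1 - ε)^2 - (Ebound Γ L ε)^2
          ≤ (1 / (k : ℝ)) * ∑ i, ((U * (ρt (S i) 0)ᵀ * Uᴴ * ρ (S i) 0).trace).re) := by
  have hk2 : 2 ≤ k := by omega
  have hk0 : (0 : ℝ) < k := by exact_mod_cast (by omega : 0 < k)
  have hε1 : 0 < 1 - ε := by linarith
  choose r hr hr1 using fun x => (hρ x 0).exists_eq_blochMatrix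
  have hr' : ∀ x, ρ x 1 = blochMatrix 1 (-r x) := by
    intro x
    rw [eq_sub_of_add_eq' (hρsum x), hr, one_sub_blochMatrix]; norm_num
  choose s hs hs1 using fun x a => (hρt x a).exists_eq_blochMatrix
  choose p m hm using fun y => (hMt y 0).isHermitian.exists_eq_blochMatrix
  have hm1 : ∀ y, ‖m y‖ ≤ 1 - |p y - 1| := by
    intro y
    have h0 := norm_le_of_posSemidef_blochMatrix (hm y ▸ hMt y 0)
    have h1 := hMt y 1
    rw [eq_sub_of_add_eq' (hMtsum y), hm, one_sub_blochMatrix] at h1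
    have h2 := norm_le_of_posSemidef_blochMatrix h1
    rw [norm_neg] at h2
    rcases abs_cases (p y - 1) with ⟨h, _⟩ | ⟨h, _⟩ <;> rw [h] <;> linarith
  have hstat0 : ∀ x y, |(p y - 1) + inner ℝ (s x 0) (m y) - inner ℝ (r x) (r y)| ≤ 2 * ε := by
    intro x y
    have h := hstat x y 0 0
    rw [hs, hm, hr, hr, re_trace_blochMatrix_mul, re_trace_blochMatrix_mul, abs_le] at h
    rw [abs_le]
    constructor <;> linarith [h.1, h.2]
  have hdisc : ∀ y, 1 - 2 * ε ≤ (p y - 1) + inner ℝ (s y 0) (m y) := by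
    intro y
    have h := (abs_le.1 (hstat0 y y)).1
    rw [real_inner_self_eq_norm_sq, hr1] at h
    linarith
  have hdisc' : ∀ y, 1 - 2 * ε ≤ -(p y - 1) - inner ℝ (s y 1) (m y) := by
    intro y
    have h := (abs_le.1 (hstat y y 1 0)).2
    rw [hs, hm, hr', hr, re_trace_blochMatrix_mul, re_trace_blochMatrix_mul, inner_neg_left,
      real_inner_self_eq_norm_sq, hr1] at h
    linarith
  have hεsq : ε = √ε ^ 2 := (Real.sq_sqrt hε0).symm
  have hpurity : ∀ x, 1 - 4 * (ε * (1 - 2 * ε) / (1 - ε) ^ 2) ≤ ‖s x 0‖ ^ 2 := by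
    intro x
    have h := le_norm_mul_of_discriminated (hs1 x 0) (hs1 x 1) (hm1 x) (hdisc x) (hdisc' x)
    have h2 := pow_le_pow_left₀ (by linarith) h 2
    have h3 : 1 - 4 * (ε * (1 - 2 * ε) / (1 - ε) ^ 2) = (1 - 3 * ε) ^ 2 / (1 - ε) ^ 2 := by
      field_simp; ring
    rw [h3, div_le_iff₀ (by positivity), ← mul_pow]
    exact h2
  have hδ : ε * (1 - 2 * ε) / (1 - ε) ^ 2 ≤ ε := by
    rw [div_le_iff₀ (by positivity)]
    nlinarith [pow_nonneg hε0 3]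
  obtain ⟨T, hT⟩ := exists_linearIsometryEquiv_sum_sq_le (r := fun i => r (S i))
    (s := fun i => s (S i) 0) hk2 hε0 (by linarith) (fun i => hr1 (S i))
    (fun i j => by rw [hΓ, hr, hr, re_trace_blochMatrix_mul]; ring) hΓpd hChol hsmall
    (fun i j _ => abs_inner_sub_le_of_discriminated (hs1 _ 0) (hs1 _ 1) (hs1 _ 0) (hm1 _)
      (hdisc _) (hdisc' _) (Real.sqrt_nonneg ε) hεsq (hstat0 _ _))
    (fun i => by
      have h1 : ‖s (S i) 0‖ ^ 2 ≤ 1 := pow_le_one₀ (norm_nonneg _) (hs1 _ 0)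
      rw [abs_of_nonpos (by linarith), ← hεsq]
      nlinarith [hpurity (S i), mul_nonneg (Real.sqrt_nonneg ε) hε0])
  have hmain : 1 - ε * (1 - 2 * ε) / (1 - ε)^2 - (Ebound Γ L ε)^2
      ≤ (1 / (k : ℝ)) * ∑ i, ((blochMatrix 1 (T (s (S i) 0)) * ρ (S i) 0).trace).re := by
    have hfid : ∀ i, 1 - ε * (1 - 2 * ε) / (1 - ε)^2 - ‖T (s (S i) 0) - r (S i)‖ ^ 2 / 4
        ≤ ((blochMatrix 1 (T (s (S i) 0)) * ρ (S i) 0).trace).re := by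
      intro i
      rw [hr, re_trace_blochMatrix_mul, norm_sub_sq_real, T.norm_map, hr1]
      linarith [hpurity (S i)]
    have hsum := Finset.sum_le_sum fun i (_ : i ∈ Finset.univ) => hfid i
    rw [Finset.sum_sub_distrib, ← Finset.sum_div, Finset.sum_const, Finset.card_univ,
      Fintype.card_fin, nsmul_eq_mul] at hsum
    rw [one_div_mul_eq_div, le_div_iff₀ hk0]
    linarith
  obtain ⟨U, hU, h | h⟩ := isImplementedByUnitary_all T
  · exact ⟨U, hU, Or.inl (by simpa only [hs, h] using hmain)⟩
  · exact ⟨U, hU, Or.inr (by simpa only [hs, h] using hmain)⟩
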